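/- Let n ≥ 3 be an integer, let 0 < q < 1 and let x ∈ [0,1]. Then x² + [2]_q x(1−x)(1−qⁿx)/[n−1]_q − ([2]_q [3]_q q^{n−1}/([n−1]_q [n−2]_q)) x(1−x)(1−qx)(1−qⁿx) ≤ D_n^q(e_2)(x) ≤ x² + [2]_q x(1−x)(1−qⁿx)/[n−1]_q. -/

import Mathlib

/-- The `q`-integer `[n]_q = 1 + q + ⋯ + q^{n-1}`. -/
noncomputable def qInt (q : ℝ) (n : ℕ) : ℝ := ∑ k ∈ Finset.range n, q ^ k

/-- The `q`-factorial `[n]_q!`. -/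
noncomputable def qFact (q : ℝ) (n : ℕ) : ℝ := ∏ k ∈ Finset.range n, qInt q (k + 1)

/-- The `q`-binomial coefficient `[m choose r]_q`. -/
noncomputable def qBinom (q : ℝ) (m r : ℕ) : ℝ := qFact q m / (qFact q r * qFact q (m - r))

/-- The Jackson `q`-integral of `g` over `[0,1]`. -/
noncomputable def qIntegral (q : ℝ) (g : ℝ → ℝ) : ℝ := (1 - q) * ∑' m : ℕ, q ^ m * g (q ^ m)

/-- The `q`-shifted factorial `(t;q)_n`. -/
noncomputable def qShift (q t : ℝ) (n : ℕ) : ℝ := ∏ j ∈ Finset.range n, (1 - t * q ^ j)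

/-- The `q`-beta function `B_q(m,n)`. -/
noncomputable def qBeta (q : ℝ) (m n : ℕ) : ℝ :=
  qIntegral q (fun t => t ^ (m - 1) * qShift q (q * t) (n - 1))

/-- The weight `m_{n,k,q}(x) = (x;q)_{n+1} [n+k choose k]_q x^k`. -/
noncomputable def mWeight (q : ℝ) (n k : ℕ) (x : ℝ) : ℝ :=
  qShift q x (n + 1) * qBinom q (n + k) k * x ^ k

/-- The `q`-MKZ–Durrmeyer operator. -/
noncomputable def Durr (q : ℝ) (n : ℕ) (f : ℝ → ℝ) (x : ℝ) : ℝ :=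
  if x = 1 then f 1
  else mWeight q n 0 x * f 0 +
    ∑' k : ℕ, mWeight q n (k + 1) x * (1 / qBeta q n (k + 1)) *
      qIntegral q (fun t => t ^ k * qShift q (q * t) (n - 1) * f t)

lemma qInt_succ (q : ℝ) (n : ℕ) : qInt q (n + 1) = qInt q n + q ^ n :=
  Finset.sum_range_succ _ _

lemma qInt_add (q : ℝ) (m n : ℕ) : qInt q (m + n) = qInt q m + q ^ m * qInt q n := by
  simp only [qInt, Finset.sum_range_add, Finset.mul_sum, pow_add]

lemma qInt_succ_pos {q : ℝ} (hq : 0 < q) (n : ℕ) : 0 < qInt q (n + 1) :=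
  Finset.sum_pos (fun _ _ => pow_pos hq _) (by simp)

lemma one_sub_mul_qInt (q : ℝ) (n : ℕ) : (1 - q) * qInt q n = 1 - q ^ n :=
  mul_neg_geom_sum q n

lemma qFact_succ (q : ℝ) (n : ℕ) : qFact q (n + 1) = qFact q n * qInt q (n + 1) :=
  Finset.prod_range_succ _ _

lemma qFact_pos {q : ℝ} (hq : 0 < q) (n : ℕ) : 0 < qFact q n :=
  Finset.prod_pos fun _ _ => qInt_succ_pos hq _

lemma qBinom_add (q : ℝ) (n j : ℕ) :
    qBinom q (n + j) j = qFact q (n + j) / (qFact q j * qFact q n) := by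
  rw [qBinom, Nat.add_sub_cancel]

lemma qBinom_add_pos {q : ℝ} (hq : 0 < q) (n j : ℕ) : 0 < qBinom q (n + j) j := by
  rw [qBinom_add]
  exact div_pos (qFact_pos hq _) (mul_pos (qFact_pos hq _) (qFact_pos hq _))

lemma qBinom_zero_right {q : ℝ} (hq : 0 < q) (n : ℕ) : qBinom q n 0 = 1 := by
  have := (qFact_pos hq n).ne'
  simp only [qBinom, qFact, Finset.range_zero, Finset.prod_empty, one_mul, Nat.sub_zero] at this ⊢
  exact div_self this

lemma qBinom_succ_left_mul {q : ℝ} (hq : 0 < q) (n j : ℕ) :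
    qBinom q (n + 1 + j) j * qInt q (n + 1) = qBinom q (n + j) j * qInt q (n + 1 + j) := by
  have h1 := (qFact_pos hq n).ne'
  have h2 := (qFact_pos hq j).ne'
  have h3 := (qInt_succ_pos hq n).ne'
  rw [qBinom_add, qBinom_add, qFact_succ q n, show n + 1 + j = n + j + 1 by ring,
    qFact_succ q (n + j)]
  field_simp

lemma qBinom_succ_right_mul {q : ℝ} (hq : 0 < q) (n j : ℕ) :
    qBinom q (n + (j + 1)) (j + 1) * qInt q (j + 1) =
      qBinom q (n + j) j * qInt q (n + j + 1) := by
  have h1 := (qFact_pos hq n).ne'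
  have h2 := (qFact_pos hq j).ne'
  have h3 := (qInt_succ_pos hq j).ne'
  rw [qBinom_add, qBinom_add, qFact_succ q j, ← add_assoc, qFact_succ q (n + j)]
  field_simp

lemma qBinom_pascal {q : ℝ} (hq : 0 < q) (n j : ℕ) :
    qBinom q (n + 1 + (j + 1)) (j + 1) =
      qBinom q (n + (j + 1)) (j + 1) + q ^ (n + 1) * qBinom q (n + 1 + j) j := by
  have h1 := qBinom_succ_left_mul hq n (j + 1)
  have h2 := qBinom_succ_right_mul hq (n + 1) j
  have h3 := qInt_add q (n + 1) (j + 1)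
  have h4 := (qInt_succ_pos hq (n + 1 + j)).ne'
  rw [← add_assoc] at h3
  apply mul_right_cancel₀ h4
  rw [← add_assoc] at h1 h2 ⊢
  linear_combination (qBinom q (n + 1 + j + 1) (j + 1)) * h3 + h1 + q ^ (n + 1) * h2

lemma qBinom_pascal' {q : ℝ} (hq : 0 < q) (n j : ℕ) :
    qBinom q (n + 1 + (j + 1)) (j + 1) =
      qBinom q (n + 1 + j) j + q ^ (j + 1) * qBinom q (n + (j + 1)) (j + 1) := by
  have h1 := qBinom_succ_left_mul hq n (j + 1)
  have h2 := qBinom_succ_right_mul hq (n + 1) j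
  have h3 := qInt_add q (j + 1) (n + 1)
  have h4 := (qInt_succ_pos hq (n + 1 + j)).ne'
  rw [show j + 1 + (n + 1) = n + 1 + j + 1 by ring] at h3
  apply mul_right_cancel₀ h4
  rw [← add_assoc] at h1 h2 ⊢
  linear_combination (qBinom q (n + 1 + j + 1) (j + 1)) * h3 + q ^ (j + 1) * h1 + h2

lemma qShift_succ (q x : ℝ) (n : ℕ) : qShift q x (n + 1) = qShift q x n * (1 - x * q ^ n) :=
  Finset.prod_range_succ _ _

lemma qShift_succ' (q x : ℝ) (n : ℕ) :
    qShift q x (n + 1) = (1 - x) * qShift q (q * x) n := by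
  rw [qShift, Finset.prod_range_succ', mul_comm, qShift]
  congr 1
  · simp
  · exact Finset.prod_congr rfl fun j _ => by ring

lemma qShift_pos {q x : ℝ} (hq0 : 0 < q) (hq1 : q < 1) (hx0 : 0 ≤ x) (hx1 : x < 1) (n : ℕ) :
    0 < qShift q x n :=
  Finset.prod_pos fun _ _ => sub_pos.2 <|
    (mul_le_of_le_one_right hx0 (pow_le_one₀ hq0.le hq1.le)).trans_lt hx1

lemma hasSum_of_linear_recurrence {u v : ℕ → ℝ} {r s : ℝ} (hr0 : 0 ≤ r) (hr1 : r < 1)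
    (hv : ∀ j, 0 ≤ v j) (hu : ∀ j, 0 ≤ u j) (h0 : v 0 = u 0)
    (hs : ∀ j, v (j + 1) = u (j + 1) + r * v j) (h : HasSum u s) :
    HasSum v (s / (1 - r)) := by
  have hr : 0 < 1 - r := sub_pos.2 hr1
  have hs0 : 0 ≤ s := h.nonneg hu
  have hrec : ∀ N, ∑ j ∈ Finset.range (N + 1), v j =
      ∑ j ∈ Finset.range (N + 1), u j + r * ∑ j ∈ Finset.range N, v j := by
    intro N
    rw [Finset.sum_range_succ', Finset.sum_range_succ' u, Finset.mul_sum, h0]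
    simp only [hs, Finset.sum_add_distrib]
    ring
  have hbound : ∀ N, ∑ j ∈ Finset.range N, v j ≤ s / (1 - r) := by
    intro N
    induction N with
    | zero => simpa using div_nonneg hs0 hr.le
    | succ N ih =>
      rw [hrec]
      calc _ ≤ s + r * (s / (1 - r)) :=
            add_le_add (sum_le_hasSum _ (fun j _ => hu j) h) (mul_le_mul_of_nonneg_left ih hr0)
        _ = s / (1 - r) := by field_simp; ring
  obtain ⟨t, ht⟩ := summable_of_sum_range_le hv hbound
  have h1 : HasSum (fun j => v (j + 1)) (t - v 0) := by
    simpa using (hasSum_nat_add_iff' 1).2 ht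
  have h2 : HasSum (fun j => u (j + 1)) (s - u 0) := by
    simpa using (hasSum_nat_add_iff' 1).2 h
  have h3 : t - v 0 = s - u 0 + r * t :=
    h1.unique (by simpa only [hs] using h2.add (ht.mul_left r))
  have : t = s / (1 - r) := by
    rw [eq_div_iff hr.ne']
    linear_combination h3 + h0
  rwa [← this]

/-- The `q`-binomial series. -/
lemma hasSum_qBinom {q x : ℝ} (hq0 : 0 < q) (hq1 : q < 1) (hx0 : 0 ≤ x) (hx1 : x < 1) (n : ℕ) :
    HasSum (fun j => qBinom q (n + j) j * x ^ j) (1 / qShift q x (n + 1)) := by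
  induction n with
  | zero =>
    have h : ∀ j, qBinom q (0 + j) j = 1 := fun j => by
      rw [qBinom_add, zero_add]
      simpa [qFact] using div_self (qFact_pos hq0 j).ne'
    simp only [h, one_mul]
    simpa [qShift] using hasSum_geometric_of_lt_one hx0 hx1
  | succ n ih =>
    have hr1 : x * q ^ (n + 1) < 1 :=
      (mul_le_of_le_one_right hx0 (pow_le_one₀ hq0.le hq1.le)).trans_lt hx1
    rw [qShift_succ, ← div_div]
    refine hasSum_of_linear_recurrence (by positivity) hr1 (fun j => ?_) (fun j => ?_) ?_
      (fun j => ?_) ih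
    · exact mul_nonneg (qBinom_add_pos hq0 _ _).le (pow_nonneg hx0 _)
    · exact mul_nonneg (qBinom_add_pos hq0 _ _).le (pow_nonneg hx0 _)
    · simp only [qBinom_zero_right hq0]
    · rw [qBinom_pascal hq0]
      ring

lemma qFact_mul_qShift (q : ℝ) (m n : ℕ) :
    qFact q m * qShift q (q ^ (m + 1)) n = (1 - q) ^ n * qFact q (n + m) := by
  induction n with
  | zero => simp [qShift]
  | succ n ih =>
    have h := one_sub_mul_qInt q (n + m + 1)
    rw [qShift_succ, ← mul_assoc, ih, show n + 1 + m = n + m + 1 by ring, qFact_succ,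
      ← pow_add, show m + 1 + n = n + m + 1 by ring, ← h]
    ring

/-- The `q`-beta integral. -/
lemma qIntegral_pow_mul_qShift {q : ℝ} (hq0 : 0 < q) (hq1 : q < 1) (k n : ℕ) :
    qIntegral q (fun t => t ^ k * qShift q (q * t) n) =
      qFact q k * qFact q n / qFact q (n + k + 1) := by
  have hq : 0 < 1 - q := sub_pos.2 hq1
  have hterm : ∀ m : ℕ, q ^ m * ((q ^ m) ^ k * qShift q (q * q ^ m) n) =
      (1 - q) ^ n * qFact q n * (qBinom q (n + m) m * (q ^ (k + 1)) ^ m) := by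
    intro m
    have h1 := (qFact_pos hq0 m).ne'
    have h2 := (qFact_pos hq0 n).ne'
    have h := qFact_mul_qShift q m n
    rw [← pow_succ', qBinom_add]
    field_simp
    rw [← h]
    ring
  have hsum := (hasSum_qBinom hq0 hq1 (pow_nonneg hq0.le (k + 1))
    (pow_lt_one₀ hq0.le hq1 (Nat.succ_ne_zero k)) n).mul_left ((1 - q) ^ n * qFact q n)
  have hden := qFact_mul_qShift q k (n + 1)
  have h1 := (qShift_pos hq0 hq1 (pow_nonneg hq0.le (k + 1))
    (pow_lt_one₀ hq0.le hq1 (Nat.succ_ne_zero k)) (n + 1)).ne'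
  have h2 := (qFact_pos hq0 (n + k + 1)).ne'
  rw [qIntegral]
  simp only [hterm]
  rw [hsum.tsum_eq]
  rw [show n + 1 + k = n + k + 1 by ring] at hden
  field_simp
  linear_combination -qFact q n * hden

lemma Durr_sq_term {q : ℝ} (hq0 : 0 < q) (hq1 : q < 1) (n k : ℕ) (x : ℝ) :
    mWeight q (n + 1) (k + 1) x * (1 / qBeta q (n + 1) (k + 1)) *
        qIntegral q (fun t => t ^ k * qShift q (q * t) (n + 1 - 1) * t ^ 2) =
      qShift q x (n + 2) * x *
        (qBinom q (n + 1 + k) k * qInt q (k + 2) / qInt q (n + k + 3) * x ^ k) := by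
  have hI : qIntegral q (fun t => t ^ k * qShift q (q * t) (n + 1 - 1) * t ^ 2) =
      qFact q (k + 2) * qFact q n / qFact q (n + k + 3) := by
    have := qIntegral_pow_mul_qShift hq0 hq1 (k + 2) n
    rw [show n + k + 3 = n + (k + 2) + 1 by ring, ← this]
    congr 1
    ext t
    rw [Nat.add_sub_cancel]
    ring
  have hB : qBeta q (n + 1) (k + 1) = qFact q n * qFact q k / qFact q (n + k + 1) := by
    have := qIntegral_pow_mul_qShift hq0 hq1 n k
    rw [add_comm n k, ← this]
    rfl
  have hb := qBinom_succ_right_mul hq0 (n + 1) k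
  have h1 := (qFact_pos hq0 n).ne'
  have h2 := (qFact_pos hq0 k).ne'
  have h3 := (qFact_pos hq0 (n + k + 1)).ne'
  have h4 := (qInt_succ_pos hq0 (n + k + 1)).ne'
  have h5 := (qInt_succ_pos hq0 (n + k + 2)).ne'
  rw [show n + 1 + k + 1 = n + k + 2 by ring] at hb
  rw [hI, hB, mWeight, qFact_succ q (k + 1), qFact_succ q k, qFact_succ q (n + k + 2),
    qFact_succ q (n + k + 1)]
  simp only [Nat.add_assoc, Nat.reduceAdd] at *
  field_simp
  linear_combination qShift q x (n + 2) * x * x ^ k * qInt q (k + 2) * hb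

lemma qBinom_mul_qInt_eq {q : ℝ} (hq0 : 0 < q) (n k : ℕ) :
    qBinom q (n + 1 + (k + 1)) (k + 1) * qInt q (k + 1 + 2) / qInt q (n + (k + 1) + 3) =
      qBinom q (n + 1 + k) k +
        qInt q 2 * (q ^ (k + 1) * qBinom q (n + (k + 1)) (k + 1) / qInt q (n + (k + 1) + 3)) := by
  have h1 := qBinom_pascal' hq0 n k
  have h2 := qBinom_succ_right_mul hq0 (n + 1) k
  have h3 := qInt_add q 2 (k + 1)
  have h4 := qInt_add q 2 (n + 1 + k + 1)
  have h5 := (qInt_succ_pos hq0 (n + (k + 1) + 2)).ne'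
  rw [show 2 + (n + 1 + k + 1) = n + (k + 1) + 2 + 1 by ring] at h4
  rw [add_comm 2] at h3
  rw [h3, show n + (k + 1) + 3 = n + (k + 1) + 2 + 1 by ring]
  field_simp
  linear_combination q ^ 2 * h2 + qInt q 2 * h1 - qBinom q (n + 1 + k) k * h4

lemma Durr_sq_eq {q x T : ℝ} (hq0 : 0 < q) (hq1 : q < 1) (hx0 : 0 ≤ x) (hx1 : x < 1) (n : ℕ)
    (hT : HasSum (fun j => qBinom q (n + j) j / qInt q (n + j + 3) * (q * x) ^ j) T) :
    Durr q (n + 1) (fun t => t ^ 2) x = x ^ 2 + qInt q 2 * x * qShift q x (n + 2) * T := by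
  have hP := (qShift_pos hq0 hq1 hx0 hx1 (n + 2)).ne'
  have h1 : HasSum (fun k => qBinom q (n + 1 + k) k * qInt q (k + 2) / qInt q (n + k + 3) * x ^ k)
      (x * (1 / qShift q x (n + 2)) + qInt q 2 * T) := by
    rw [← hasSum_nat_add_iff' 1]
    have hT' := (hasSum_nat_add_iff' 1).2 hT
    convert ((hasSum_qBinom hq0 hq1 hx0 hx1 (n + 1)).mul_left x).add (hT'.mul_left (qInt q 2))
      using 1
    · rfl
    · ext k
      rw [qBinom_mul_qInt_eq hq0]
      ring
    · simp only [Finset.range_one, Finset.sum_singleton, qBinom_zero_right hq0, pow_zero,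
        zero_add, add_zero]
      ring
  rw [Durr, if_neg hx1.ne]
  simp only [Durr_sq_term hq0 hq1]
  rw [(h1.mul_left _).tsum_eq]
  field_simp
  ring

lemma qBinom_div_le {q : ℝ} (hq0 : 0 < q) (p j : ℕ) :
    qBinom q (p + 2 + j) j / qInt q (p + 2 + j + 3) ≤
      1 / qInt q (p + 2) * qBinom q (p + 1 + j) j := by
  have h1 := qBinom_succ_left_mul hq0 (p + 1) j
  have h2 := qInt_succ_pos hq0 (p + 1)
  have h3 := qInt_succ_pos hq0 (p + 2 + j + 2)
  have h4 := qInt_add q (p + 2 + j) 3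
  have h5 := qInt_succ_pos hq0 2
  have h6 := qBinom_add_pos hq0 (p + 1) j
  simp only [Nat.add_assoc, Nat.reduceAdd] at *
  rw [one_div, ← div_eq_inv_mul, div_le_div_iff₀ h3 h2, h1]
  refine mul_le_mul_of_nonneg_left ?_ h6.le
  rw [h4]
  exact le_add_of_nonneg_right (by positivity)

lemma le_qBinom_div {q : ℝ} (hq0 : 0 < q) (p j : ℕ) :
    1 / qInt q (p + 2) * qBinom q (p + 1 + j) j -
        q ^ (p + 2) * qInt q 3 / (qInt q (p + 2) * qInt q (p + 1)) *
          (q ^ j * qBinom q (p + j) j) ≤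
      qBinom q (p + 2 + j) j / qInt q (p + 2 + j + 3) := by
  have hb := qBinom_succ_left_mul hq0 (p + 1) j
  have hc := qBinom_succ_left_mul hq0 p j
  have h1 := qInt_succ_pos hq0 p
  have h2 := qInt_succ_pos hq0 (p + 1)
  have h3 := qInt_succ_pos hq0 (p + 2 + j + 2)
  have h4 := qInt_add q (p + 2 + j) 3
  have h5 := qInt_succ_pos hq0 2
  have h6 := qBinom_add_pos hq0 p j
  have h8 := qInt_add q (p + 1 + j) 4
  have h9 := qInt_succ_pos hq0 3
  have hle : qInt q (p + 1 + j) ≤ qInt q (p + 2 + j + 3) := by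
    rw [show p + 2 + j + 3 = p + 1 + j + 4 by ring, h8]
    exact le_add_of_nonneg_right (by positivity)
  have hc' : qBinom q (p + 1 + j) j = qBinom q (p + j) j * qInt q (p + 1 + j) / qInt q (p + 1) := by
    rw [eq_div_iff h1.ne', hc]
  have hb' : qBinom q (p + 2 + j) j =
      qBinom q (p + 1 + j) j * qInt q (p + 2 + j) / qInt q (p + 2) := by
    rw [eq_div_iff h2.ne', hb]
  have hsub : qBinom q (p + 2 + j) j / qInt q (p + 2 + j + 3) -
      (1 / qInt q (p + 2) * qBinom q (p + 1 + j) j -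
        q ^ (p + 2) * qInt q 3 / (qInt q (p + 2) * qInt q (p + 1)) *
          (q ^ j * qBinom q (p + j) j)) =
      q ^ (p + 2 + j) * qInt q 3 * qBinom q (p + j) j *
        (qInt q (p + 2 + j + 3) - qInt q (p + 1 + j)) /
        (qInt q (p + 2) * qInt q (p + 1) * qInt q (p + 2 + j + 3)) := by
    rw [hb', hc', pow_add q (p + 2) j]
    rw [pow_add q (p + 2) j] at h4
    have h3' : qInt q (p + 2 + j + 3) ≠ 0 := h3.ne'
    have h1' := h1.ne'
    have h2' : qInt q (p + 2) ≠ 0 := h2.ne'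
    field_simp
    linear_combination -qInt q (p + 1 + j) * h4
  rw [← sub_nonneg, hsub]
  have h3' : 0 < qInt q (p + 2 + j + 3) := h3
  have h2' : 0 < qInt q (p + 2) := h2
  have h5' : 0 < qInt q 3 := h5
  have := sub_nonneg.2 hle
  positivity

theorem stmt5 (q : ℝ) (hq0 : 0 < q) (hq1 : q < 1) (n : ℕ) (hn : 3 ≤ n)
    (x : ℝ) (hx : x ∈ Set.Icc (0 : ℝ) 1) :
    x ^ 2 + qInt q 2 * x * (1 - x) * (1 - q ^ n * x) / qInt q (n - 1) -
        (qInt q 2 * qInt q 3 * q ^ (n - 1) / (qInt q (n - 1) * qInt q (n - 2))) *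
          (x * (1 - x) * (1 - q * x) * (1 - q ^ n * x)) ≤
      Durr q n (fun t => t ^ 2) x ∧
    Durr q n (fun t => t ^ 2) x ≤
      x ^ 2 + qInt q 2 * x * (1 - x) * (1 - q ^ n * x) / qInt q (n - 1) := by
  obtain ⟨hx0, hx1⟩ := hx
  rcases hx1.eq_or_lt with rfl | hx1
  · simp [Durr]
  obtain ⟨p, rfl⟩ : ∃ p, n = p + 3 := ⟨n - 3, by omega⟩
  rw [show p + 3 - 1 = p + 2 by omega, show p + 3 - 2 = p + 1 by omega]
  have hqx0 : 0 ≤ q * x := by positivity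
  have hqx1 : q * x < 1 := by nlinarith
  have hqqx0 : 0 ≤ q * (q * x) := by positivity
  have hqqx1 : q * (q * x) < 1 := by nlinarith
  have hc := (hasSum_qBinom hq0 hq1 hqx0 hqx1 (p + 1)).mul_left (1 / qInt q (p + 2))
  have hd := (hasSum_qBinom hq0 hq1 hqqx0 hqqx1 p).mul_left
    (q ^ (p + 2) * qInt q 3 / (qInt q (p + 2) * qInt q (p + 1)))
  have hup : ∀ j, qBinom q (p + 2 + j) j / qInt q (p + 2 + j + 3) * (q * x) ^ j ≤
      1 / qInt q (p + 2) * (qBinom q (p + 1 + j) j * (q * x) ^ j) := fun j => by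
    rw [← mul_assoc]
    exact mul_le_mul_of_nonneg_right (qBinom_div_le hq0 p j) (by positivity)
  have hlow : ∀ j, 1 / qInt q (p + 2) * (qBinom q (p + 1 + j) j * (q * x) ^ j) -
      q ^ (p + 2) * qInt q 3 / (qInt q (p + 2) * qInt q (p + 1)) *
        (qBinom q (p + j) j * (q * (q * x)) ^ j) ≤
      qBinom q (p + 2 + j) j / qInt q (p + 2 + j + 3) * (q * x) ^ j := fun j => by
    refine le_trans (le_of_eq ?_)
      (mul_le_mul_of_nonneg_right (le_qBinom_div hq0 p j) (pow_nonneg hqx0 j))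
    rw [mul_pow q (q * x)]
    ring
  obtain ⟨T, hT⟩ := Summable.of_nonneg_of_le (fun j => mul_nonneg
    (div_nonneg (qBinom_add_pos hq0 (p + 2) j).le (qInt_succ_pos hq0 (p + 2 + j + 2)).le)
    (pow_nonneg hqx0 j)) hup hc.summable
  have hT1 := hasSum_le hup hT hc
  have hT2 := hasSum_le hlow (hc.sub hd) hT
  rw [Durr_sq_eq hq0 hq1 hx0 hx1 (p + 2) hT]
  have hC : 0 ≤ qInt q 2 * x * qShift q x (p + 2 + 2) :=
    mul_nonneg (mul_nonneg (qInt_succ_pos hq0 1).le hx0) (qShift_pos hq0 hq1 hx0 hx1 _).le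
  have hP : qShift q x (p + 2 + 2) =
      (1 - x) * (qShift q (q * x) (p + 2) * (1 - q * x * q ^ (p + 2))) := by
    rw [qShift_succ', qShift_succ]
  have hR := qShift_succ' q (q * x) (p + 1)
  have hS := (qShift_pos hq0 hq1 hqqx0 hqqx1 (p + 1)).ne'
  have hqx : 1 - q * x ≠ 0 := (sub_pos.2 hqx1).ne'
  have h1 := (qInt_succ_pos hq0 p).ne'
  have h2 : qInt q (p + 2) ≠ 0 := (qInt_succ_pos hq0 (p + 1)).ne'
  have hU := mul_le_mul_of_nonneg_left hT1 hC
  have hL := mul_le_mul_of_nonneg_left hT2 hC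
  rw [hP, show p + 1 + 1 = p + 2 from rfl, hR] at hU hL
  rw [hP, hR]
  generalize qShift q (q * (q * x)) (p + 1) = S at hS hU hL ⊢
  generalize 1 - q * x = A at hqx hU hL ⊢
  constructor
  · rw [add_sub_assoc]
    refine add_le_add_right (le_trans (le_of_eq ?_) hL) _
    field_simp
    ring
  · refine add_le_add_right (hU.trans (le_of_eq ?_)) _
    field_simp
    ring
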